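/- For every pair of locally integrable complex-valued functions f, g on ℝ, the functions E_{f,g}, C_{f,g} = (E_{f,g} + E_{−f,−g})/2 and S_{f,g} = (E_{f,g} − E_{−f,−g})/2 are locally absolutely continuous on ℝ, and satisfy almost everywhere the differential formulas (C_{f,g})′ = g · S_{f,g} and (S_{f,g})′ = f · C_{f,g}. -/

import Mathlib

open MeasureTheory intervalIntegral Filter

noncomputable section

/-- Alternating product f(s1)g(s2)f(s3)⋯ with j factors (index 0 ↦ f). -/
def altProd (f g : ℝ → ℂ) (j : ℕ) (s : Fin j → ℝ) : ℂ :=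
  ∏ i : Fin j, if (i : ℕ) % 2 = 0 then f (s i) else g (s i)

/-- The signed simplex integral A_j(f,g,x). -/
def simplexA (f g : ℝ → ℂ) (j : ℕ) (x : ℝ) : ℂ :=
  if 0 ≤ x then
    ∫ s in {s : Fin j → ℝ | StrictMono s ∧ ∀ i, s i ∈ Set.Ioo 0 x}, altProd f g j s
  else
    (-1 : ℂ) ^ j *
      ∫ s in {s : Fin j → ℝ | StrictAnti s ∧ ∀ i, s i ∈ Set.Ioo x 0}, altProd f g j s

/-- The bivariate exponential E_{f,g}. -/
def bivE (f g : ℝ → ℂ) (x : ℝ) : ℂ := 1 + ∑' j : ℕ, simplexA f g (j + 1) x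

def bivC (f g : ℝ → ℂ) (x : ℝ) : ℂ := (bivE f g x + bivE (-f) (-g) x) / 2

def bivS (f g : ℝ → ℂ) (x : ℝ) : ℂ := (bivE f g x - bivE (-f) (-g) x) / 2

/-- Locally absolutely continuous complex-valued function on ℝ. -/
def LocAC (F : ℝ → ℂ) : Prop :=
  ∃ F' : ℝ → ℂ, LocallyIntegrable F' volume ∧
    ∀ x : ℝ, F x = F 0 + ∫ t in (0:ℝ)..x, F' t

end

/-- Iterated primitives: `iterPrimitive h j x` is the integral of `h 0 s₁ * ⋯ * h (j-1) sⱼ` over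
`0 < s₁ < ⋯ < sⱼ < x`, with the usual sign convention for negative `x`. -/
noncomputable def iterPrimitive (h : ℕ → ℝ → ℂ) : ℕ → ℝ → ℂ
  | 0 => fun _ => 1
  | j + 1 => fun x => ∫ t in (0 : ℝ)..x, h j t * iterPrimitive h j t

/-- The open ordered simplex `0 < s₁ < ⋯ < sⱼ < x`. -/
def orderedSimplex (j : ℕ) (x : ℝ) : Set (Fin j → ℝ) :=
  {s | StrictMono s ∧ ∀ i, s i ∈ Set.Ioo 0 x}

lemma measurableSet_orderedSimplex (j : ℕ) (x : ℝ) : MeasurableSet (orderedSimplex j x) := by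
  have : orderedSimplex j x = (⋂ (a : Fin j) (b : Fin j) (_ : a < b), {s | s a < s b}) ∩
      ⋂ i, {s | s i ∈ Set.Ioo 0 x} := by
    ext s; simp [orderedSimplex, StrictMono]
  rw [this]
  refine MeasurableSet.inter ?_ ?_
  · exact .iInter fun a => .iInter fun b => .iInter fun _ =>
      measurableSet_lt (measurable_pi_apply a) (measurable_pi_apply b)
  · exact .iInter fun i => measurableSet_Ioo.preimage (measurable_pi_apply i)

lemma snoc_mem_orderedSimplex {j : ℕ} {x t : ℝ} {s : Fin j → ℝ} :
    (Fin.snoc s t : Fin (j + 1) → ℝ) ∈ orderedSimplex (j + 1) x ↔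
      t ∈ Set.Ioo 0 x ∧ s ∈ orderedSimplex j t := by
  constructor
  · rintro ⟨hm, hI⟩
    refine ⟨by simpa using hI (Fin.last j), ?_, fun i => ⟨?_, ?_⟩⟩
    · intro a b hab
      simpa using hm (Fin.castSucc_lt_castSucc_iff.2 hab)
    · simpa using (hI i.castSucc).1
    · simpa using hm (Fin.castSucc_lt_last i)
  · rintro ⟨ht, hm, hI⟩
    refine ⟨fun a b => ?_, fun i => ?_⟩
    · induction a using Fin.lastCases with
      | last => exact fun hab => absurd hab (not_lt.2 (Fin.le_last b))
      | cast a =>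
        induction b using Fin.lastCases with
        | last => intro _; simpa using (hI a).2
        | cast b => intro hab; simpa using hm (Fin.castSucc_lt_castSucc_iff.1 hab)
    · induction i using Fin.lastCases with
      | last => simpa using ht
      | cast i => simpa using And.intro (hI i).1 ((hI i).2.trans ht.2)

lemma integrableOn_prod_orderedSimplex {h : ℕ → ℝ → ℂ} (hh : ∀ n, LocallyIntegrable (h n) volume)
    (j : ℕ) (x : ℝ) :
    IntegrableOn (fun s : Fin j → ℝ => ∏ i : Fin j, h i (s i)) (orderedSimplex j x) volume := by
  have hbox : IntegrableOn (fun s : Fin j → ℝ => ∏ i : Fin j, h i (s i))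
      (Set.univ.pi fun _ => Set.Ioo 0 x) volume := by
    rw [IntegrableOn, volume_pi, Measure.restrict_pi_pi]
    exact Integrable.fintype_prod (f := fun i : Fin j => h i) fun i =>
      ((hh i).integrableOn_isCompact isCompact_Icc).mono_set Set.Ioo_subset_Icc_self
  exact hbox.mono_set fun s hs i _ => hs.2 i

lemma setIntegral_orderedSimplex_succ {h : ℕ → ℝ → ℂ} (hh : ∀ n, LocallyIntegrable (h n) volume)
    (j : ℕ) (x : ℝ) :
    ∫ s in orderedSimplex (j + 1) x, ∏ i : Fin (j + 1), h i (s i) =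
      ∫ t in Set.Ioo 0 x, h j t * ∫ s in orderedSimplex j t, ∏ i : Fin j, h i (s i) := by
  have hmp := (volume_preserving_piFinSuccAbove (fun _ : Fin (j + 1) => ℝ) (Fin.last j)).symm
  have hint := (integrableOn_prod_orderedSimplex hh (j + 1) x).integrable_indicator
    (measurableSet_orderedSimplex (j + 1) x)
  rw [← MeasureTheory.integral_indicator (measurableSet_orderedSimplex _ _), ← hmp.integral_comp',
    Measure.volume_eq_prod, integral_prod (fun p => (orderedSimplex (j + 1) x).indicator
      (fun s : Fin (j + 1) → ℝ => ∏ i : Fin (j + 1), h i (s i))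
      ((MeasurableEquiv.piFinSuccAbove (fun _ : Fin (j + 1) => ℝ) (Fin.last j)).symm p))
      (hmp.integrable_comp_of_integrable hint),
    ← MeasureTheory.integral_indicator measurableSet_Ioo]
  refine integral_congr_ae (.of_forall fun t => ?_)
  have key : ∀ s : Fin j → ℝ, (orderedSimplex (j + 1) x).indicator
      (fun s : Fin (j + 1) → ℝ => ∏ i : Fin (j + 1), h i (s i))
      ((MeasurableEquiv.piFinSuccAbove (fun _ : Fin (j + 1) => ℝ) (Fin.last j)).symm (t, s)) =
      (Set.Ioo 0 x).indicator (fun t => h j t * (orderedSimplex j t).indicator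
        (fun s : Fin j → ℝ => ∏ i : Fin j, h i (s i)) s) t := by
    intro s
    have hs : (MeasurableEquiv.piFinSuccAbove (fun _ : Fin (j + 1) => ℝ) (Fin.last j)).symm (t, s)
        = (Fin.snoc s t : Fin (j + 1) → ℝ) := by
      simp [MeasurableEquiv.piFinSuccAbove, Fin.insertNthEquiv]
    rw [hs]
    classical
    simp only [Set.indicator_apply, snoc_mem_orderedSimplex, Fin.prod_univ_castSucc]
    by_cases h1 : t ∈ Set.Ioo 0 x <;> by_cases h2 : s ∈ orderedSimplex j t <;>
      simp [h1, h2, mul_comm]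
  simp only [key]
  by_cases ht : t ∈ Set.Ioo 0 x
  · simp only [Set.indicator_of_mem ht]
    rw [MeasureTheory.integral_const_mul,
      MeasureTheory.integral_indicator (measurableSet_orderedSimplex _ _)]
  · simp only [Set.indicator_of_notMem ht, MeasureTheory.integral_zero]

lemma setIntegral_orderedSimplex {h : ℕ → ℝ → ℂ} (hh : ∀ n, LocallyIntegrable (h n) volume)
    (j : ℕ) {x : ℝ} (hx : 0 ≤ x) :
    ∫ s in orderedSimplex j x, ∏ i : Fin j, h i (s i) = iterPrimitive h j x := by
  induction j generalizing x with
  | zero =>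
    have : orderedSimplex 0 x = Set.univ := by
      ext s; simp [orderedSimplex, Subsingleton.strictMono]
    rw [this, Measure.restrict_univ, volume_pi, Measure.pi_of_empty]
    simp [iterPrimitive]
  | succ j ih =>
    simp only [iterPrimitive]
    rw [setIntegral_orderedSimplex_succ hh, intervalIntegral.integral_of_le hx,
      integral_Ioc_eq_integral_Ioo]
    exact setIntegral_congr_fun measurableSet_Ioo fun t ht => by simp only [ih ht.1.le]

lemma iterPrimitive_comp_neg (h : ℕ → ℝ → ℂ) (j : ℕ) (x : ℝ) :
    iterPrimitive (fun n t => h n (-t)) j x = (-1) ^ j * iterPrimitive h j (-x) := by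
  induction j generalizing x with
  | zero => simp [iterPrimitive]
  | succ j ih =>
    simp only [iterPrimitive, ih]
    rw [intervalIntegral.integral_comp_neg
      (fun t => h j t * ((-1) ^ j * iterPrimitive h j t)), neg_zero,
      intervalIntegral.integral_symm, pow_succ, mul_neg_one, neg_mul]
    simp only [mul_left_comm _ ((-1 : ℂ) ^ j), intervalIntegral.integral_const_mul]

lemma iterPrimitive_neg (h : ℕ → ℝ → ℂ) (j : ℕ) (x : ℝ) :
    iterPrimitive (fun n => -h n) j x = (-1) ^ j * iterPrimitive h j x := by
  induction j generalizing x with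
  | zero => simp [iterPrimitive]
  | succ j ih =>
    simp only [iterPrimitive, ih]
    rw [← intervalIntegral.integral_const_mul]
    exact intervalIntegral.integral_congr fun t _ => by simp only [Pi.neg_apply]; ring

lemma locallyIntegrable_comp_neg {E : Type*} [NormedAddCommGroup E] {f : ℝ → E}
    (hf : LocallyIntegrable f volume) : LocallyIntegrable (fun t => f (-t)) volume := by
  rw [locallyIntegrable_iff]
  intro k hk
  have := (Measure.measurePreserving_neg (volume : Measure ℝ)).integrableOn_comp_preimage
    (Homeomorph.neg ℝ).measurableEmbedding (f := f) (s := -k)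
  simpa [Function.comp_def] using this.2 (hf.integrableOn_isCompact hk.neg)

/-- The alternating sequence `f, g, f, g, …`. -/
def altSeq (f g : ℝ → ℂ) (n : ℕ) : ℝ → ℂ := if n % 2 = 0 then f else g

lemma locallyIntegrable_altSeq {f g : ℝ → ℂ} (hf : LocallyIntegrable f volume)
    (hg : LocallyIntegrable g volume) (n : ℕ) : LocallyIntegrable (altSeq f g n) volume := by
  unfold altSeq; split_ifs <;> assumption

lemma altProd_eq_prod_altSeq (f g : ℝ → ℂ) (j : ℕ) (s : Fin j → ℝ) :
    altProd f g j s = ∏ i : Fin j, altSeq f g i (s i) :=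
  Finset.prod_congr rfl fun i _ => by unfold altSeq; split_ifs <;> rfl

lemma simplexA_eq_iterPrimitive {f g : ℝ → ℂ} (hf : LocallyIntegrable f volume)
    (hg : LocallyIntegrable g volume) (j : ℕ) (x : ℝ) :
    simplexA f g j x = iterPrimitive (altSeq f g) j x := by
  have hh := locallyIntegrable_altSeq hf hg
  unfold simplexA
  split_ifs with hx
  · simp only [altProd_eq_prod_altSeq]
    exact setIntegral_orderedSimplex hh j hx
  · have hmp : MeasurePreserving (fun s : Fin j → ℝ => -s) volume volume :=
      Measure.measurePreserving_neg _
    have hpre : (fun s : Fin j → ℝ => -s) ⁻¹'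
        {s : Fin j → ℝ | StrictAnti s ∧ ∀ i, s i ∈ Set.Ioo x 0} = orderedSimplex j (-x) := by
      ext s
      refine and_congr ⟨fun H a b hab => ?_, fun H a b hab => ?_⟩ (forall_congr' fun i => ?_)
      · simpa using H hab
      · simpa using H hab
      · simp only [Pi.neg_apply, Set.mem_Ioo]
        constructor <;> rintro ⟨h1, h2⟩ <;> constructor <;> linarith
    rw [← hmp.setIntegral_preimage_emb (Homeomorph.neg _).measurableEmbedding, hpre]
    simp only [altProd_eq_prod_altSeq, Pi.neg_apply]
    rw [setIntegral_orderedSimplex (h := fun n t => altSeq f g n (-t))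
      (fun n => locallyIntegrable_comp_neg (hh n)) j (by linarith : 0 ≤ -x),
      iterPrimitive_comp_neg, neg_neg, ← mul_assoc, ← mul_pow]
    simp

lemma intervalIntegrable_of_locallyIntegrable {E : Type*} [NormedAddCommGroup E] {f : ℝ → E}
    (hf : LocallyIntegrable f volume) (a b : ℝ) : IntervalIntegrable f volume a b :=
  (hf.integrableOn_isCompact isCompact_uIcc).intervalIntegrable

lemma integral_mul_pow_primitive {k : ℝ → ℝ} (hk : LocallyIntegrable k volume) (n : ℕ) (x : ℝ) :
    ∫ t in (0 : ℝ)..x, k t * (∫ s in (0 : ℝ)..t, k s) ^ n =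
      (∫ s in (0 : ℝ)..x, k s) ^ (n + 1) / (n + 1) := by
  set K : ℝ → ℝ := fun t => ∫ s in (0 : ℝ)..t, k s with hK
  have hac : AbsolutelyContinuousOnInterval K 0 x :=
    (intervalIntegrable_of_locallyIntegrable hk 0 x
      ).absolutelyContinuousOnInterval_intervalIntegral Set.left_mem_uIcc
  have hpow : ∀ m : ℕ, AbsolutelyContinuousOnInterval (fun t => K t ^ (m + 1)) 0 x := by
    intro m
    induction m with
    | zero => simpa using hac
    | succ m ih =>
      simp only [pow_succ _ (m + 1)]
      exact ih.mul hac
  have hFTC := (hpow n).integral_deriv_eq_sub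
  have hcongr : ∫ t in (0 : ℝ)..x, deriv (fun t => K t ^ (n + 1)) t =
      ∫ t in (0 : ℝ)..x, ((n : ℝ) + 1) * (k t * K t ^ n) := by
    refine intervalIntegral.integral_congr_ae ?_
    filter_upwards [LocallyIntegrable.ae_hasDerivAt_integral hk] with t ht _
    have hd : HasDerivAt (fun t => K t ^ (n + 1)) _ t := (ht 0).pow (n + 1)
    rw [hd.deriv]
    push_cast
    simp only [hK]
    ring
  have h0 : K 0 = 0 := by simp [hK]
  rw [hcongr, intervalIntegral.integral_const_mul, h0, zero_pow n.succ_ne_zero, sub_zero] at hFTC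
  rw [eq_div_iff (by positivity), mul_comm]
  exact hFTC

lemma continuous_iterPrimitive {h : ℕ → ℝ → ℂ} (hh : ∀ n, LocallyIntegrable (h n) volume)
    (j : ℕ) : Continuous (iterPrimitive h j) := by
  induction j with
  | zero => exact continuous_const
  | succ j ih =>
    exact intervalIntegral.continuous_primitive
      (fun a b => intervalIntegrable_of_locallyIntegrable ((hh j).mul_continuous ih) a b) 0

lemma norm_iterPrimitive_le_of_nonneg {h : ℕ → ℝ → ℂ}
    {k : ℝ → ℝ} (hk : LocallyIntegrable k volume)
    (hhk : ∀ n t, ‖h n t‖ ≤ k t) (j : ℕ) {x : ℝ} (hx : 0 ≤ x) :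
    ‖iterPrimitive h j x‖ ≤ (∫ t in (0 : ℝ)..x, k t) ^ j / j.factorial := by
  induction j generalizing x with
  | zero => simp [iterPrimitive]
  | succ j ih =>
    have hKc : Continuous fun t => (∫ s in (0 : ℝ)..t, k s) ^ j :=
      (intervalIntegral.continuous_primitive
        (intervalIntegrable_of_locallyIntegrable hk) 0).pow j
    calc ‖iterPrimitive h (j + 1) x‖
        ≤ ∫ t in (0 : ℝ)..x, k t * (∫ s in (0 : ℝ)..t, k s) ^ j / j.factorial := by
          refine intervalIntegral.norm_integral_le_of_norm_le hx (.of_forall fun t ht => ?_) ?_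
          · rw [norm_mul, mul_div_assoc]
            exact mul_le_mul (hhk j t) (ih ht.1.le) (norm_nonneg _)
              ((norm_nonneg _).trans (hhk j t))
          · exact (intervalIntegrable_of_locallyIntegrable (hk.mul_continuous hKc) _ _).div_const _
      _ = (∫ t in (0 : ℝ)..x, k t) ^ (j + 1) / (j + 1).factorial := by
          rw [intervalIntegral.integral_div, integral_mul_pow_primitive hk, div_div,
            Nat.factorial_succ]
          push_cast
          rfl

lemma norm_iterPrimitive_le {h : ℕ → ℝ → ℂ}
    {k : ℝ → ℝ} (hk : LocallyIntegrable k volume)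
    (hhk : ∀ n t, ‖h n t‖ ≤ k t) (j : ℕ) (x : ℝ) :
    ‖iterPrimitive h j x‖ ≤ |∫ t in (0 : ℝ)..x, k t| ^ j / j.factorial := by
  rcases le_total 0 x with hx | hx
  · refine (norm_iterPrimitive_le_of_nonneg hk hhk j hx).trans ?_
    rw [abs_of_nonneg
      (intervalIntegral.integral_nonneg hx fun t _ => (norm_nonneg _).trans (hhk 0 t))]
  · have := norm_iterPrimitive_le_of_nonneg (h := fun n t => h n (-t)) (k := fun t => k (-t))
      (locallyIntegrable_comp_neg hk)
      (fun n t => hhk n (-t)) j (neg_nonneg.2 hx)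
    rw [iterPrimitive_comp_neg, neg_neg, norm_mul, norm_pow, norm_neg, norm_one, one_pow, one_mul,
      intervalIntegral.integral_comp_neg, neg_neg, neg_zero] at this
    rwa [intervalIntegral.integral_symm, abs_neg, abs_of_nonneg
      (intervalIntegral.integral_nonneg hx fun t _ => (norm_nonneg _).trans (hhk 0 t))]

lemma exists_norm_iterPrimitive_le {h : ℕ → ℝ → ℂ}
    {k : ℝ → ℝ} (hk : LocallyIntegrable k volume)
    (hhk : ∀ n t, ‖h n t‖ ≤ k t) (R : ℝ) :
    ∃ M : ℝ, ∀ (j : ℕ) (x : ℝ), |x| ≤ R → ‖iterPrimitive h j x‖ ≤ M ^ j / j.factorial := by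
  refine ⟨|∫ t in (-R)..R, k t|, fun j x hx => (norm_iterPrimitive_le hk hhk j x).trans ?_⟩
  have hR : 0 ≤ R := (abs_nonneg x).trans hx
  have hsub : Set.uIoc 0 x ⊆ Set.uIoc (-R) R := by
    rw [abs_le] at hx
    intro t ht
    rw [Set.mem_uIoc] at ht ⊢
    left
    rcases ht with ht | ht <;> constructor <;> linarith [ht.1, ht.2, hx.1, hx.2]
  refine div_le_div_of_nonneg_right (pow_le_pow_left₀ (abs_nonneg _) ?_ j) (by positivity)
  exact intervalIntegral.abs_integral_mono_interval hsub
    (.of_forall fun t => (norm_nonneg _).trans (hhk 0 t)) (intervalIntegrable_of_locallyIntegrable hk _ _)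

section Subseries

variable {h : ℕ → ℝ → ℂ} {k : ℝ → ℝ} {φ : ℕ → ℕ}

lemma summable_iterPrimitive (hk : LocallyIntegrable k volume) (hhk : ∀ n t, ‖h n t‖ ≤ k t)
    (hφ : Function.Injective φ) (x : ℝ) : Summable fun m => iterPrimitive h (φ m) x := by
  obtain ⟨M, hM⟩ := exists_norm_iterPrimitive_le hk hhk |x|
  exact .of_norm_bounded ((Real.summable_pow_div_factorial M).comp_injective hφ)
    fun m => hM (φ m) x le_rfl

lemma continuous_tsum_iterPrimitive (hh : ∀ n, LocallyIntegrable (h n) volume)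
    (hk : LocallyIntegrable k volume) (hhk : ∀ n t, ‖h n t‖ ≤ k t)
    (hφ : Function.Injective φ) : Continuous fun x => ∑' m, iterPrimitive h (φ m) x := by
  rw [continuous_iff_continuousAt]
  intro x
  obtain ⟨M, hM⟩ := exists_norm_iterPrimitive_le hk hhk (|x| + 1)
  have hcont : ContinuousOn (fun x => ∑' m, iterPrimitive h (φ m) x) {y | |y| ≤ |x| + 1} :=
    continuousOn_tsum (fun m => (continuous_iterPrimitive hh (φ m)).continuousOn)
      ((Real.summable_pow_div_factorial M).comp_injective hφ) fun m y hy => hM (φ m) y hy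
  refine hcont.continuousAt ?_
  filter_upwards [(continuous_abs.tendsto x).eventually_lt_const (lt_add_one |x|)] with y hy
  exact hy.le

lemma hasSum_iterPrimitive_succ (hh : ∀ n, LocallyIntegrable (h n) volume)
    (hk : LocallyIntegrable k volume) (hhk : ∀ n t, ‖h n t‖ ≤ k t)
    (hφ : Function.Injective φ) {q : ℝ → ℂ} (hq : ∀ m, h (φ m) = q) (x : ℝ) :
    HasSum (fun m => iterPrimitive h (φ m + 1) x)
      (∫ t in (0 : ℝ)..x, q t * ∑' m, iterPrimitive h (φ m) t) := by
  obtain ⟨M, hM⟩ := exists_norm_iterPrimitive_le hk hhk |x|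
  have hsum := (Real.summable_pow_div_factorial M).comp_injective hφ
  refine intervalIntegral.hasSum_integral_of_dominated_convergence
    (fun m t => k t * (M ^ φ m / (φ m).factorial)) (fun m => ?_) (fun m => ?_) ?_ ?_ ?_
  · exact ((hh (φ m)).mul_continuous (continuous_iterPrimitive hh (φ m))
      ).aestronglyMeasurable.restrict
  · refine .of_forall fun t ht => ?_
    have htx : |t| ≤ |x| := by
      rcases Set.mem_uIoc.1 ht with ht | ht
      · rw [abs_of_pos ht.1]; exact ht.2.trans (le_abs_self x)
      · rw [abs_of_nonpos ht.2]; exact (neg_le_neg ht.1.le).trans (neg_le_abs x)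
    rw [norm_mul]
    exact mul_le_mul (hhk _ t) (hM _ t htx) (norm_nonneg _) ((norm_nonneg _).trans (hhk 0 t))
  · exact .of_forall fun t _ => hsum.mul_left (k t)
  · simp only [tsum_mul_left]
    exact (intervalIntegrable_of_locallyIntegrable hk _ _).mul_const _
  · refine .of_forall fun t _ => ?_
    simp only [hq]
    exact (summable_iterPrimitive hk hhk hφ t).hasSum.mul_left (q t)

end Subseries

lemma injective_two_mul : Function.Injective fun m : ℕ => 2 * m :=
  fun a b hab => by simpa using hab

lemma injective_two_mul_add_one : Function.Injective fun m : ℕ => 2 * m + 1 :=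
  fun a b hab => by simpa using hab

lemma altSeq_two_mul (f g : ℝ → ℂ) (m : ℕ) : altSeq f g (2 * m) = f := by
  simp [altSeq]

lemma altSeq_two_mul_add_one (f g : ℝ → ℂ) (m : ℕ) : altSeq f g (2 * m + 1) = g := by
  simp [altSeq, Nat.add_mod]

lemma altSeq_neg (f g : ℝ → ℂ) : altSeq (-f) (-g) = fun n => -altSeq f g n := by
  funext n; unfold altSeq; split_ifs <;> rfl

lemma norm_altSeq_le (f g : ℝ → ℂ) (n : ℕ) (t : ℝ) : ‖altSeq f g n t‖ ≤ ‖f t‖ + ‖g t‖ := by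
  unfold altSeq; split_ifs <;> simp

lemma LocAC.of_primitive {F F' : ℝ → ℂ} (hF' : LocallyIntegrable F' volume) (c : ℂ)
    (hF : ∀ x, F x = c + ∫ t in (0 : ℝ)..x, F' t) : LocAC F :=
  ⟨F', hF', fun x => by rw [hF x, hF 0]; simp⟩

lemma ae_hasDerivAt_of_primitive {F F' : ℝ → ℂ} (hF' : LocallyIntegrable F' volume) (c : ℂ)
    (hF : ∀ x, F x = c + ∫ t in (0 : ℝ)..x, F' t) : ∀ᵐ x : ℝ, HasDerivAt F (F' x) x := by
  obtain rfl : F = fun x => c + ∫ t in (0 : ℝ)..x, F' t := funext hF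
  filter_upwards [LocallyIntegrable.ae_hasDerivAt_integral hF'] with x hx
  exact (hx 0).const_add c

section Series

variable {f g : ℝ → ℂ}

lemma locallyIntegrable_norm_add_norm (hf : LocallyIntegrable f volume)
    (hg : LocallyIntegrable g volume) :
    LocallyIntegrable (fun t => ‖f t‖ + ‖g t‖) volume :=
  LocallyIntegrable.add (fun x => (hf x).norm) fun x => (hg x).norm

lemma bivE_eq_tsum_add_tsum (hf : LocallyIntegrable f volume) (hg : LocallyIntegrable g volume)
    (x : ℝ) : bivE f g x = ∑' m, iterPrimitive (altSeq f g) (2 * m) x +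
      ∑' m, iterPrimitive (altSeq f g) (2 * m + 1) x := by
  have hs {φ : ℕ → ℕ} (hφ : Function.Injective φ) :=
    summable_iterPrimitive (locallyIntegrable_norm_add_norm hf hg) (norm_altSeq_le f g) hφ x
  rw [tsum_even_add_odd (f := fun j => iterPrimitive (altSeq f g) j x) (hs injective_two_mul)
    (hs injective_two_mul_add_one), (show Summable fun j => iterPrimitive (altSeq f g) j x from
      hs Function.injective_id).tsum_eq_zero_add, bivE]
  simp [simplexA_eq_iterPrimitive hf hg, iterPrimitive]

lemma bivE_neg_eq_tsum_sub_tsum (hf : LocallyIntegrable f volume)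
    (hg : LocallyIntegrable g volume) (x : ℝ) :
    bivE (-f) (-g) x = ∑' m, iterPrimitive (altSeq f g) (2 * m) x -
      ∑' m, iterPrimitive (altSeq f g) (2 * m + 1) x := by
  rw [bivE_eq_tsum_add_tsum hf.neg hg.neg, altSeq_neg]
  simp [iterPrimitive_neg, pow_succ, pow_mul, tsum_neg, sub_eq_add_neg]

lemma bivC_eq_tsum (hf : LocallyIntegrable f volume) (hg : LocallyIntegrable g volume) :
    bivC f g = fun x => ∑' m, iterPrimitive (altSeq f g) (2 * m) x := by
  funext x
  rw [bivC, bivE_neg_eq_tsum_sub_tsum hf hg, bivE_eq_tsum_add_tsum hf hg]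
  ring

lemma bivS_eq_tsum (hf : LocallyIntegrable f volume) (hg : LocallyIntegrable g volume) :
    bivS f g = fun x => ∑' m, iterPrimitive (altSeq f g) (2 * m + 1) x := by
  funext x
  rw [bivS, bivE_neg_eq_tsum_sub_tsum hf hg, bivE_eq_tsum_add_tsum hf hg]
  ring

lemma continuous_bivC (hf : LocallyIntegrable f volume) (hg : LocallyIntegrable g volume) :
    Continuous (bivC f g) := by
  rw [bivC_eq_tsum hf hg]
  exact continuous_tsum_iterPrimitive (locallyIntegrable_altSeq hf hg)
    (locallyIntegrable_norm_add_norm hf hg) (norm_altSeq_le f g) injective_two_mul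

lemma continuous_bivS (hf : LocallyIntegrable f volume) (hg : LocallyIntegrable g volume) :
    Continuous (bivS f g) := by
  rw [bivS_eq_tsum hf hg]
  exact continuous_tsum_iterPrimitive (locallyIntegrable_altSeq hf hg)
    (locallyIntegrable_norm_add_norm hf hg) (norm_altSeq_le f g) injective_two_mul_add_one

lemma bivS_eq_integral (hf : LocallyIntegrable f volume) (hg : LocallyIntegrable g volume)
    (x : ℝ) : bivS f g x = ∫ t in (0 : ℝ)..x, f t * bivC f g t := by
  rw [bivS_eq_tsum hf hg, bivC_eq_tsum hf hg]
  exact (hasSum_iterPrimitive_succ (locallyIntegrable_altSeq hf hg)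
    (locallyIntegrable_norm_add_norm hf hg) (norm_altSeq_le f g) injective_two_mul
    (altSeq_two_mul f g) x).tsum_eq

lemma bivC_eq_integral (hf : LocallyIntegrable f volume) (hg : LocallyIntegrable g volume)
    (x : ℝ) : bivC f g x = 1 + ∫ t in (0 : ℝ)..x, g t * bivS f g t := by
  have hk := locallyIntegrable_norm_add_norm hf hg
  have hh := locallyIntegrable_altSeq hf hg
  rw [bivS_eq_tsum hf hg, bivC_eq_tsum hf hg]
  dsimp only
  rw [(summable_iterPrimitive hk (norm_altSeq_le f g) injective_two_mul x).tsum_eq_zero_add,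
    ← (hasSum_iterPrimitive_succ hh hk (norm_altSeq_le f g) injective_two_mul_add_one
      (altSeq_two_mul_add_one f g) x).tsum_eq]
  rfl

end Series

theorem bivCS_locAC_and_deriv (f g : ℝ → ℂ)
    (hf : LocallyIntegrable f volume) (hg : LocallyIntegrable g volume) :
    LocAC (bivE f g) ∧ LocAC (bivC f g) ∧ LocAC (bivS f g) ∧
    (∀ᵐ x : ℝ, HasDerivAt (bivC f g) (g x * bivS f g x) x) ∧
    (∀ᵐ x : ℝ, HasDerivAt (bivS f g) (f x * bivC f g x) x) := by
  have hC' : LocallyIntegrable (fun t => g t * bivS f g t) volume :=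
    hg.mul_continuous (continuous_bivS hf hg)
  have hS' : LocallyIntegrable (fun t => f t * bivC f g t) volume :=
    hf.mul_continuous (continuous_bivC hf hg)
  have hC := bivC_eq_integral hf hg
  have hS : ∀ x, bivS f g x = 0 + ∫ t in (0 : ℝ)..x, f t * bivC f g t := fun x => by
    rw [zero_add, bivS_eq_integral hf hg]
  refine ⟨.of_primitive (hC'.add hS') 1 fun x => ?_, .of_primitive hC' 1 hC,
    .of_primitive hS' 0 hS, ae_hasDerivAt_of_primitive hC' 1 hC,
    ae_hasDerivAt_of_primitive hS' 0 hS⟩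
  have hE : bivE f g x = bivC f g x + bivS f g x := by rw [bivC, bivS]; ring
  simp only [Pi.add_apply]
  rw [intervalIntegral.integral_add (intervalIntegrable_of_locallyIntegrable hC' _ _)
    (intervalIntegrable_of_locallyIntegrable hS' _ _), hE, hC x, hS x]
  ring
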